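/- Assume |∇A(x)|² ≤ h a(x) A(x) for all x ∈ Ω with a constant h > 0, and let 0 < β < 2/h. Set γ₁ := min(2 − βh, β) > 0. Then for every t > 0 the function t ↦ E₁(t;u) is differentiable and satisfies (d/dt) E₁(t;u) ≤ −γ₁ F(t;u). -/

import Mathlib

open MeasureTheory Real

/-- The Laplacian of `f : ℝ^N → ℝ`, as the sum of the second partial derivatives. -/
noncomputable def lap {N : ℕ} (f : EuclideanSpace ℝ (Fin N) → ℝ)
    (x : EuclideanSpace ℝ (Fin N)) : ℝ :=
  ∑ i : Fin N, fderiv ℝ (fun y => fderiv ℝ f y (EuclideanSpace.single i 1)) x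
    (EuclideanSpace.single i 1)

/-- A real function has nonzero derivative at only countably many of its zeros. -/
theorem countable_zero_deriv_ne_zero (f : ℝ → ℝ) :
    {t | f t = 0 ∧ deriv f t ≠ 0}.Countable := by
  set s := {t | f t = 0 ∧ deriv f t ≠ 0}
  refine (HereditarilyLindelofSpace.isLindelof s).countable_of_isDiscrete
    (isDiscrete_iff_nhdsNE.2 fun t ht => ?_)
  have hd : HasDerivAt f (deriv f t) t :=
    (differentiableAt_of_deriv_ne_zero ht.2).hasDerivAt
  rw [← disjoint_iff, Filter.disjoint_principal_right]
  filter_upwards [hd.eventually_ne (c := 0) ht.2] with z hz hzs using hz hzs.1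

/-- Directional derivatives of a continuous function vanish almost everywhere on its zero set. -/
theorem ae_lineDeriv_eq_zero_of_eq_zero {E : Type*} [NormedAddCommGroup E] [NormedSpace ℝ E]
    [FiniteDimensional ℝ E] [MeasurableSpace E] [BorelSpace E] (μ : Measure E)
    [μ.IsAddHaarMeasure] {f : E → ℝ} (hf : Continuous f) (v : E) :
    ∀ᵐ x ∂μ, f x = 0 → lineDeriv ℝ f x v = 0 := by
  let L : ℝ →L[ℝ] E := ContinuousLinearMap.smulRight (1 : ℝ →L[ℝ] ℝ) v
  have hmeas : MeasurableSet {x | f x = 0 → lineDeriv ℝ f x v = 0} := by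
    have h1 : MeasurableSet {x | f x = 0} := measurableSet_eq_fun hf.measurable measurable_const
    have h2 : MeasurableSet {x | lineDeriv ℝ f x v = 0} :=
      measurableSet_eq_fun (measurable_lineDeriv hf) measurable_const
    have : {x | f x = 0 → lineDeriv ℝ f x v = 0}
        = {x | f x = 0}ᶜ ∪ {x | lineDeriv ℝ f x v = 0} := by
      ext x; simp [imp_iff_not_or]
    rw [this]
    exact h1.compl.union h2
  refine ae_mem_of_ae_add_linearMap_mem L.toLinearMap volume μ hmeas fun y => ?_
  have hc := (countable_zero_deriv_ne_zero (fun t => f (y + t • v))).ae_notMem volume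
  filter_upwards [hc] with t ht
  intro h0
  by_contra hne
  refine ht ⟨by simpa [L] using h0, ?_⟩
  have : deriv (fun r => f (y + r • v)) t = lineDeriv ℝ f (y + L t) v := by
    rw [lineDeriv]
    have := deriv_comp_const_add (f := fun r => f (y + r • v)) t 0
    simp only [add_zero] at this
    rw [← this]
    congr 1
    ext r
    simp [L, add_smul, add_assoc]
  rw [this]
  exact hne

/-- A preconnected set meeting a set and its complement meets its frontier. -/
theorem IsPreconnected.inter_frontier_nonempty {X : Type*} [TopologicalSpace X] {s t : Set X}
    (ht : IsPreconnected t) (h1 : (t ∩ s).Nonempty) (h2 : (t ∩ sᶜ).Nonempty) :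
    (t ∩ frontier s).Nonempty := by
  by_contra hempty
  have hnot : ∀ x ∈ t, x ∉ frontier s := fun x hx hf => hempty ⟨x, hx, hf⟩
  obtain ⟨x, hxt, hxs⟩ := h1
  obtain ⟨y, hyt, hys⟩ := h2
  have hcov : t ⊆ interior s ∪ (closure s)ᶜ := fun z hz => by
    by_cases hzc : z ∈ closure s
    · exact Or.inl (by_contra fun hzi => hnot z hz ⟨hzc, hzi⟩)
    · exact Or.inr hzc
  obtain ⟨z, -, hzi, hzc⟩ := ht _ _ isOpen_interior isClosed_closure.isOpen_compl hcov
    ⟨x, hxt, (hcov hxt).resolve_right fun hc => hc (subset_closure hxs)⟩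
    ⟨y, hyt, (hcov hyt).resolve_left fun hi => hys (interior_subset hi)⟩
  exact hzc (subset_closure (interior_subset hzi))

/-- Cutting a Lipschitz function off outside a set on whose frontier it vanishes keeps it
Lipschitz. -/
theorem LipschitzWith.indicator_of_eq_zero_on_frontier {E : Type*} [NormedAddCommGroup E]
    [NormedSpace ℝ E] {C : NNReal} {g : E → ℝ} (hg : LipschitzWith C g) {Ω : Set E}
    (h0 : ∀ x ∈ frontier Ω, g x = 0) : LipschitzWith C (Ω.indicator g) := by
  have key : ∀ x ∈ Ω, ∀ y ∉ Ω, |g x| ≤ C * dist x y := by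
    intro x hx y hy
    obtain ⟨z, hz, hzf⟩ := IsPreconnected.inter_frontier_nonempty
      (convex_segment (𝕜 := ℝ) x y).isPreconnected (s := Ω) ⟨x, left_mem_segment ℝ x y, hx⟩ ⟨y, right_mem_segment ℝ x y, hy⟩
    have h1 := hg.dist_le_mul x z
    rw [h0 z hzf, Real.dist_eq, sub_zero] at h1
    have h2 := dist_add_dist_of_mem_segment hz
    refine h1.trans (mul_le_mul_of_nonneg_left ?_ C.2)
    linarith [dist_nonneg (x := z) (y := y)]
  refine LipschitzWith.of_dist_le_mul fun x y => ?_
  by_cases hx : x ∈ Ω <;> by_cases hy : y ∈ Ω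
  · simpa [hx, hy] using hg.dist_le_mul x y
  · simpa [hx, hy] using key x hx y hy
  · simpa [hx, hy, dist_comm] using key y hy x hx
  · simpa [hx, hy] using mul_nonneg C.2 dist_nonneg

/-- A directional derivative of a compactly supported `C¹` function vanishing on the frontier of
an open set has zero integral over this set. -/
theorem setIntegral_fderiv_eq_zero {E : Type*} [NormedAddCommGroup E] [NormedSpace ℝ E]
    [FiniteDimensional ℝ E] [MeasurableSpace E] [BorelSpace E] (μ : Measure E)
    [μ.IsAddHaarMeasure] {Ω : Set E} (hΩ : IsOpen Ω) {g : E → ℝ} (hg : ContDiff ℝ 1 g)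
    (hgc : HasCompactSupport g) (h0 : ∀ x ∈ frontier Ω, g x = 0) (v : E) :
    ∫ x in Ω, fderiv ℝ g x v ∂μ = 0 := by
  obtain ⟨C, hC⟩ := hg.lipschitzWith_of_hasCompactSupport hgc one_ne_zero
  have hL := hC.indicator_of_eq_zero_on_frontier h0
  have hc : HasCompactSupport (Ω.indicator g) :=
    hgc.mono fun x hx => fun h => hx (by simp [Set.indicator, h])
  have hint := (LipschitzWith.const (1 : ℝ)).integral_lineDeriv_mul_eq (μ := μ) hL hc (-v)
  have hconst : ∀ x w : E, lineDeriv ℝ (fun _ : E => (1 : ℝ)) x w = 0 := by simp [lineDeriv]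
  simp only [hconst, neg_neg, zero_mul, mul_one, integral_zero] at hint
  rw [← integral_indicator hΩ.measurableSet]
  refine Eq.trans (integral_congr_ae ?_) hint.symm
  filter_upwards [ae_lineDeriv_eq_zero_of_eq_zero μ hL.continuous v] with x hx
  by_cases hxΩ : x ∈ Ω
  · have heq : Ω.indicator g =ᶠ[nhds x] g := by
      filter_upwards [hΩ.mem_nhds hxΩ] with y hy using Set.indicator_of_mem hy g
    rw [Set.indicator_of_mem hxΩ, heq.lineDeriv_eq,
      (hg.differentiable one_ne_zero).differentiableAt.lineDeriv_eq_fderiv]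
  · rw [Set.indicator_of_notMem hxΩ, hx (Set.indicator_of_notMem hxΩ g)]

/-- Differentiation under the integral sign for an integrand with uniformly compact support. -/
theorem hasDerivAt_setIntegral_of_compact {E : Type*} [TopologicalSpace E] [T2Space E]
    [MeasurableSpace E] [BorelSpace E] (μ : Measure E)
    [IsFiniteMeasureOnCompacts μ] {Ω : Set E} {F F' : E → ℝ → ℝ} {K : Set E} (hK : IsCompact K)
    {t ε : ℝ} (hε : 0 < ε)
    (hF : ∀ s ∈ Set.Icc (t - ε) (t + ε), Continuous fun x => F x s)
    (hF' : ContinuousOn (fun p : E × ℝ => F' p.1 p.2) (Set.univ ×ˢ Set.Icc (t - ε) (t + ε)))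
    (hF0 : ∀ s ∈ Set.Icc (t - ε) (t + ε), ∀ x ∉ K, F x s = 0)
    (hF'0 : ∀ s ∈ Set.Icc (t - ε) (t + ε), ∀ x ∉ K, F' x s = 0)
    (hd : ∀ s ∈ Set.Icc (t - ε) (t + ε), ∀ x, HasDerivAt (F x) (F' x s) s) :
    HasDerivAt (fun s => ∫ x in Ω, F x s ∂μ) (∫ x in Ω, F' x t ∂μ) t := by
  have ht : t ∈ Set.Icc (t - ε) (t + ε) := ⟨by linarith, by linarith⟩
  have hint : ∀ G : E → ℝ, Continuous G → (∀ x ∉ K, G x = 0) → Integrable G μ :=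
    fun G hG h0 => hG.integrable_of_hasCompactSupport (HasCompactSupport.intro hK h0)
  have hcont' : Continuous fun x => F' x t :=
    hF'.comp_continuous (f := fun x : E => (x, t)) (by fun_prop) fun x => ⟨trivial, ht⟩
  obtain ⟨C, hC⟩ := (hK.prod (isCompact_Icc (a := t - ε) (b := t + ε))).exists_bound_of_continuousOn
    (hF'.mono (Set.prod_mono (Set.subset_univ K) subset_rfl))
  have hnhds : Set.Icc (t - ε) (t + ε) ∈ nhds t := Icc_mem_nhds (by linarith) (by linarith)
  refine (hasDerivAt_integral_of_dominated_loc_of_deriv_le (bound := K.indicator fun _ => C)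
    (F := fun s x => F x s) (F' := fun s x => F' x s)
    hnhds ?_ (hint _ (hF t ht) (hF0 t ht)).integrableOn
    (hint _ hcont' (hF'0 t ht)).integrableOn.aestronglyMeasurable ?_ ?_ ?_).2
  · filter_upwards [hnhds] with s hs
    exact (hint _ (hF s hs) (hF0 s hs)).integrableOn.aestronglyMeasurable
  · refine Filter.Eventually.of_forall fun x s hs => ?_
    by_cases hx : x ∈ K
    · simpa [hx] using hC (x, s) ⟨hx, hs⟩
    · simp [hx, hF'0 s hs x hx]
  · exact ((integrable_indicator_iff hK.measurableSet).2
      (integrableOn_const hK.measure_lt_top.ne)).integrableOn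
  · exact Filter.Eventually.of_forall fun x s hs => hd s hs x

theorem norm_gradient_sq {N : ℕ} (f : EuclideanSpace ℝ (Fin N) → ℝ)
    (x : EuclideanSpace ℝ (Fin N)) :
    ‖gradient f x‖ ^ 2 = ∑ i, (fderiv ℝ f x (EuclideanSpace.single i 1)) ^ 2 := by
  rw [EuclideanSpace.real_norm_sq_eq]
  refine Finset.sum_congr rfl fun i _ => ?_
  have h1 : inner ℝ (gradient f x) (EuclideanSpace.single i 1)
      = fderiv ℝ f x (EuclideanSpace.single i 1) := by
    simp [gradient]
  rw [← h1, EuclideanSpace.inner_single_right]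
  simp

section ProdSlices

variable {E : Type*} [NormedAddCommGroup E] [NormedSpace ℝ E] {V : E × ℝ → ℝ}

theorem hasDerivAt_slice_right {x : E} {s : ℝ} (hV : DifferentiableAt ℝ V (x, s)) :
    HasDerivAt (fun r => V (x, r)) (fderiv ℝ V (x, s) (0, 1)) s :=
  hV.hasFDerivAt.comp_hasDerivAt s ((hasDerivAt_const s x).prodMk (hasDerivAt_id s))

theorem fderiv_slice_left {x : E} {s : ℝ} (hV : DifferentiableAt ℝ V (x, s)) (w : E) :
    fderiv ℝ (fun y => V (y, s)) x w = fderiv ℝ V (x, s) (w, 0) := by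
  have h := hV.hasFDerivAt.comp x ((hasFDerivAt_id (𝕜 := ℝ) x).prodMk (hasFDerivAt_const s x))
  have h' : fderiv ℝ (fun y => V (y, s)) x = _ := h.fderiv
  rw [h']
  simp

end ProdSlices

theorem ContDiff.fderiv_apply_const {E : Type*} [NormedAddCommGroup E] [NormedSpace ℝ E]
    {V : E → ℝ} (hV : ContDiff ℝ (⊤ : ℕ∞) V) (w : E) :
    ContDiff ℝ (⊤ : ℕ∞) fun p => fderiv ℝ V p w :=
  (hV.fderiv_right (by simp)).clm_apply contDiff_const

theorem fderiv_fderiv_apply_comm {E : Type*} [NormedAddCommGroup E] [NormedSpace ℝ E]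
    {V : E → ℝ} (hV : ContDiff ℝ (⊤ : ℕ∞) V) (p v w : E) :
    fderiv ℝ (fun q => fderiv ℝ V q v) p w = fderiv ℝ (fun q => fderiv ℝ V q w) p v := by
  have hd : DifferentiableAt ℝ (fderiv ℝ V) p :=
    ((hV.fderiv_right (m := (⊤ : ℕ∞)) (by simp)).differentiable (by simp)).differentiableAt
  have hs : IsSymmSndFDerivAt ℝ V p := hV.contDiffAt.isSymmSndFDerivAt
    (by rw [minSmoothness_of_isRCLikeNormedField]
        exact WithTop.coe_le_coe.2 (le_top : (2 : ℕ∞) ≤ ⊤))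
  have key : ∀ v w : E, fderiv ℝ (fun q => fderiv ℝ V q v) p w = fderiv ℝ (fderiv ℝ V) p w v := by
    intro v w
    rw [fderiv_clm_apply hd (by fun_prop)]
    simp
  rw [key, key]
  exact hs w v

/-- The pointwise dissipation inequality behind the weighted energy estimate. -/
theorem weighted_dissipation_le {P2 B2 S q a A h β c : ℝ} (hS : S ^ 2 ≤ P2 * B2)
    (hB : B2 ≤ h * a * A) (hP : 0 ≤ P2) (ha : 0 < a) (hA : 0 < A) (hh : 0 < h) (hβ : 0 < β)
    (hc : 0 < c) :
    -2 * a * q ^ 2 - (P2 + q ^ 2) * (β * A / c ^ 2) ≤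
      2 * (β * q * S / c) - min (2 - β * h) β * ((a + A / c ^ 2) * q ^ 2) := by
  have hAP : 0 ≤ A * P2 / c ^ 2 := by positivity
  have haq : 0 ≤ h * a * q ^ 2 := by positivity
  have hsq : (2 * q * S / c) ^ 2 ≤ (A * P2 / c ^ 2 + h * a * q ^ 2) ^ 2 := by
    have h1 : (2 * q * S / c) ^ 2 ≤ 4 * (A * P2 / c ^ 2) * (h * a * q ^ 2) := by
      have : 4 * (A * P2 / c ^ 2) * (h * a * q ^ 2)
          = (4 * q ^ 2 / c ^ 2) * (P2 * (h * a * A)) := by ring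
      rw [this, show (2 * q * S / c) ^ 2 = (4 * q ^ 2 / c ^ 2) * S ^ 2 by ring]
      exact mul_le_mul_of_nonneg_left
        (hS.trans (mul_le_mul_of_nonneg_left hB hP)) (by positivity)
    nlinarith [sq_nonneg (A * P2 / c ^ 2 - h * a * q ^ 2)]
  have hcs := (abs_le.1 (abs_le_of_sq_le_sq hsq (by positivity))).1
  have hmul := mul_le_mul_of_nonneg_left hcs hβ.le
  have hγ1 : min (2 - β * h) β * (a * q ^ 2) ≤ (2 - β * h) * (a * q ^ 2) :=
    mul_le_mul_of_nonneg_right (min_le_left _ _) (by positivity)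
  have hγ2 : min (2 - β * h) β * (A / c ^ 2 * q ^ 2) ≤ β * (A / c ^ 2 * q ^ 2) :=
    mul_le_mul_of_nonneg_right (min_le_right _ _) (by positivity)
  have e1 : (P2 + q ^ 2) * (β * A / c ^ 2) = β * (A * P2 / c ^ 2) + β * (A / c ^ 2 * q ^ 2) := by
    ring
  have e2 : β * (2 * q * S / c) = 2 * (β * q * S / c) := by ring
  rw [e1]
  rw [e2] at hmul
  linarith

/-- **Estimate (eq_en1) of Lemma 3.2.** If `|∇A|² ≤ h a A` on `Ω` and `0 < β < 2/h`,
then with `γ₁ = min(2 − βh, β) > 0` the energy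
`E₁(t;u) = ∫_Ω (|∇u|² + |u_t|²) Φ_{A,β} dx` is differentiable and satisfies
`(d/dt) E₁(t;u) ≤ −γ₁ F(t;u)` where
`F(t;u) = ∫_Ω (a + A/(1+t)²) |u_t|² Φ_{A,β} dx`. -/
theorem stmt6 (N : ℕ) (hN : 2 ≤ N) (Ω : Set (EuclideanSpace ℝ (Fin N)))
    (hΩopen : IsOpen Ω) (hΩconn : IsConnected Ω) (hΩcompl : IsCompact Ωᶜ)
    (hΩ0 : (0 : EuclideanSpace ℝ (Fin N)) ∉ closure Ω)
    (a : EuclideanSpace ℝ (Fin N) → ℝ) (ha : ContDiff ℝ 2 a) (ha_pos : ∀ x, 0 < a x)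
    (a₁ a₂ α : ℝ) (ha₁ : 0 < a₁) (ha₂ : 0 < a₂) (hα : 0 ≤ α ∧ α < 1)
    (ha_bd : ∀ x : EuclideanSpace ℝ (Fin N),
      a₁ * (1 + ‖x‖) ^ (-α) ≤ a x ∧ a x ≤ a₂ * (1 + ‖x‖) ^ (-α))
    (A : EuclideanSpace ℝ (Fin N) → ℝ) (hA : ContDiff ℝ 2 A) (hA_pos : ∀ x, 0 < A x)
    (hPoisson : ∀ x, lap A x = a x)
    (u : EuclideanSpace ℝ (Fin N) → ℝ → ℝ)
    (hu : ContDiff ℝ (⊤ : ℕ∞) (fun p : EuclideanSpace ℝ (Fin N) × ℝ => u p.1 p.2))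
    (hpde : ∀ x ∈ Ω, ∀ s > (0 : ℝ),
      deriv (deriv (u x)) s - lap (fun y => u y s) x + a x * deriv (u x) s = 0)
    (hbdry : ∀ x ∈ frontier Ω, ∀ s > (0 : ℝ), u x s = 0)
    (R₀ : ℝ) (hR₀ : 0 < R₀)
    (hinit : ∀ x : EuclideanSpace ℝ (Fin N), R₀ ≤ ‖x‖ → u x 0 = 0 ∧ deriv (u x) 0 = 0)
    (hfsp : ∀ s ≥ (0 : ℝ), ∀ x : EuclideanSpace ℝ (Fin N), R₀ + s < ‖x‖ → u x s = 0)
    (h : ℝ) (hh : 0 < h)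
    (hgrad : ∀ x ∈ Ω, ‖gradient A x‖ ^ 2 ≤ h * a x * A x)
    (β : ℝ) (hβ : 0 < β) (hβ2 : β < 2 / h) :
    ∀ t > (0 : ℝ), ∃ d : ℝ,
      HasDerivAt
        (fun τ => ∫ x in Ω,
          (‖gradient (fun y => u y τ) x‖ ^ 2 + (deriv (u x) τ) ^ 2)
            * Real.exp (β * A x / (1 + τ))) d t
      ∧ d ≤ -(min (2 - β * h) β) *
          ∫ x in Ω, (a x + A x / (1 + t) ^ 2) * (deriv (u x) t) ^ 2
            * Real.exp (β * A x / (1 + t)) := by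
  intro t ht
  set U : EuclideanSpace ℝ (Fin N) × ℝ → ℝ := fun p => u p.1 p.2
  set e : Fin N → EuclideanSpace ℝ (Fin N) × ℝ := fun i => (EuclideanSpace.single i 1, 0)
  set T : EuclideanSpace ℝ (Fin N) × ℝ := (0, 1)
  set Ut : EuclideanSpace ℝ (Fin N) × ℝ → ℝ := fun p => fderiv ℝ U p T with hUt
  set Ui : Fin N → EuclideanSpace ℝ (Fin N) × ℝ → ℝ := fun i p => fderiv ℝ U p (e i) with hUi
  have cUt : ContDiff ℝ (⊤ : ℕ∞) Ut := hu.fderiv_apply_const T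
  have cUi : ∀ i, ContDiff ℝ (⊤ : ℕ∞) (Ui i) := fun i => hu.fderiv_apply_const (e i)
  have cUtt : ContDiff ℝ (⊤ : ℕ∞) fun p => fderiv ℝ Ut p T := cUt.fderiv_apply_const T
  have cUit : ∀ i, ContDiff ℝ (⊤ : ℕ∞) fun p => fderiv ℝ (Ui i) p T :=
    fun i => (cUi i).fderiv_apply_const T
  have dif : ∀ {V : EuclideanSpace ℝ (Fin N) × ℝ → ℝ}, ContDiff ℝ (⊤ : ℕ∞) V →
      ∀ p, DifferentiableAt ℝ V p := fun hV p => (hV.differentiable (by simp)).differentiableAt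
  have hut : ∀ x s, deriv (u x) s = Ut (x, s) := fun x s =>
    (hasDerivAt_slice_right (dif hu (x, s))).deriv
  have hutt : ∀ x s, deriv (deriv (u x)) s = fderiv ℝ Ut (x, s) T := fun x s => by
    rw [show deriv (u x) = fun r => Ut (x, r) from funext (hut x)]
    exact (hasDerivAt_slice_right (dif cUt (x, s))).deriv
  have hui : ∀ i x s, fderiv ℝ (fun y => u y s) x (EuclideanSpace.single i 1) = Ui i (x, s) :=
    fun i x s => fderiv_slice_left (dif hu (x, s)) _
  have hlap : ∀ x s, lap (fun y => u y s) x = ∑ i, fderiv ℝ (Ui i) (x, s) (e i) := fun x s => by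
    simp only [lap, hui]
    exact Finset.sum_congr rfl fun i _ => fderiv_slice_left (dif (cUi i) (x, s)) _
  have hgr : ∀ x s, ‖gradient (fun y => u y s) x‖ ^ 2 = ∑ i, Ui i (x, s) ^ 2 := fun x s => by
    simp only [norm_gradient_sq, hui]
  have hzero : ∀ s ∈ Set.Ioo 0 (t + 1), ∀ x ∉ Metric.closedBall 0 (R₀ + t + 1),
      fderiv ℝ U (x, s) = 0 := by
    intro s hs x hx
    rw [Metric.mem_closedBall, dist_zero_right, not_le] at hx
    have hev : U =ᶠ[nhds (x, s)] fun _ => 0 := by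
      have hopen : IsOpen {p : EuclideanSpace ℝ (Fin N) × ℝ |
          R₀ + t + 1 < ‖p.1‖ ∧ 0 < p.2 ∧ p.2 < t + 1} :=
        (isOpen_lt continuous_const continuous_fst.norm).inter
          ((isOpen_lt continuous_const continuous_snd).inter
            (isOpen_lt continuous_snd continuous_const))
      filter_upwards [hopen.mem_nhds ⟨hx, hs.1, hs.2⟩] with p hp
      exact hfsp p.2 hp.2.1.le p.1 (by linarith [hp.1, hp.2.2])
    rw [hev.fderiv_eq]
    simp
  have hUt0 : ∀ s ∈ Set.Ioo 0 (t + 1), ∀ x ∉ Metric.closedBall 0 (R₀ + t + 1),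
      Ut (x, s) = 0 := fun s hs x hx => by simp [hUt, hzero s hs x hx]
  have hUi0 : ∀ i, ∀ s ∈ Set.Ioo 0 (t + 1), ∀ x ∉ Metric.closedBall 0 (R₀ + t + 1),
      Ui i (x, s) = 0 := fun i s hs x hx => by simp [hUi, hzero s hs x hx]
  have hK : IsCompact (Metric.closedBall (0 : EuclideanSpace ℝ (Fin N)) (R₀ + t + 1)) :=
    isCompact_closedBall _ _
  have htm : t ∈ Set.Ioo 0 (t + 1) := ⟨ht, by linarith⟩
  set W' : EuclideanSpace ℝ (Fin N) → ℝ → ℝ := fun x s =>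
    (2 * ∑ i, Ui i (x, s) * fderiv ℝ (Ui i) (x, s) T + 2 * Ut (x, s) * fderiv ℝ Ut (x, s) T
      - (∑ i, Ui i (x, s) ^ 2 + Ut (x, s) ^ 2) * (β * A x / (1 + s) ^ 2))
      * Real.exp (β * A x / (1 + s)) with hW'
  have cA : Continuous A := hA.continuous
  obtain ⟨ε, hε, hεt⟩ : ∃ ε > 0, Set.Icc (t - ε) (t + ε) ⊆ Set.Ioo 0 (t + 1) :=
    ⟨min (t / 2) (1 / 2), by positivity, fun s hs => by
      have h1 := min_le_left (t / 2) (1 / 2)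
      have h2 := min_le_right (t / 2) (1 / 2)
      exact ⟨by linarith [hs.1], by linarith [hs.2]⟩⟩
  have hderiv : HasDerivAt (fun τ => ∫ x in Ω,
      (∑ i, Ui i (x, τ) ^ 2 + Ut (x, τ) ^ 2) * Real.exp (β * A x / (1 + τ)))
      (∫ x in Ω, W' x t) t := by
    refine hasDerivAt_setIntegral_of_compact volume hK hε
      (F := fun x τ => (∑ i, Ui i (x, τ) ^ 2 + Ut (x, τ) ^ 2) * Real.exp (β * A x / (1 + τ)))
      ?_ ?_ ?_ ?_ ?_
    · intro s _
      have c1 := cUt.continuous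
      have c2 := fun i => (cUi i).continuous
      fun_prop
    · have c1 := cUt.continuous
      have c2 := fun i => (cUi i).continuous
      have c3 := cUtt.continuous
      have c4 := fun i => (cUit i).continuous
      have hne : ∀ p ∈ (Set.univ : Set (EuclideanSpace ℝ (Fin N))) ×ˢ Set.Icc (t - ε) (t + ε),
          1 + p.2 ≠ 0 := fun p hp => by linarith [(hεt hp.2).1]
      have c5 : Continuous fun p : EuclideanSpace ℝ (Fin N) × ℝ => β * A p.1 := by fun_prop
      have c6 : Continuous fun p : EuclideanSpace ℝ (Fin N) × ℝ => 1 + p.2 := by fun_prop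
      refine ContinuousOn.mul (ContinuousOn.sub (Continuous.continuousOn ?_) (ContinuousOn.mul
        (Continuous.continuousOn ?_) ?_)) (Real.continuous_exp.comp_continuousOn ?_)
      · simp only [Prod.mk.eta]
        fun_prop
      · simp only [Prod.mk.eta]
        fun_prop
      · exact c5.continuousOn.div (c6.pow 2).continuousOn fun p hp => pow_ne_zero 2 (hne p hp)
      · exact c5.continuousOn.div c6.continuousOn hne
    · intro s hs x hx
      simp [hUt0 s (hεt hs) x hx, fun i => hUi0 i s (hεt hs) x hx]
    · intro s hs x hx
      simp [hW', hUt0 s (hεt hs) x hx, fun i => hUi0 i s (hεt hs) x hx]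
    · intro s hs x
      have hne : 1 + s ≠ 0 := by linarith [(hεt hs).1]
      have d1 : HasDerivAt (fun r => Ut (x, r)) (fderiv ℝ Ut (x, s) T) s :=
        hasDerivAt_slice_right (dif cUt (x, s))
      have d2 : ∀ i, HasDerivAt (fun r => Ui i (x, r)) (fderiv ℝ (Ui i) (x, s) T) s :=
        fun i => hasDerivAt_slice_right (dif (cUi i) (x, s))
      have d3 : HasDerivAt (fun τ : ℝ => β * A x / (1 + τ)) (-(β * A x / (1 + s) ^ 2)) s := by
        refine ((hasDerivAt_const s (β * A x)).fun_div
          ((hasDerivAt_id' s).const_add 1) hne).congr_deriv ?_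
        ring
      have d4 := ((HasDerivAt.fun_sum (u := Finset.univ) fun i _ => (d2 i).fun_pow 2).fun_add
        (d1.fun_pow 2)).fun_mul d3.exp
      refine d4.congr_deriv ?_
      have hsum : ∑ i, ((2 : ℕ) : ℝ) * Ui i (x, s) ^ (2 - 1) * fderiv ℝ (Ui i) (x, s) T
          = 2 * ∑ i, Ui i (x, s) * fderiv ℝ (Ui i) (x, s) T := by
        rw [Finset.mul_sum]
        exact Finset.sum_congr rfl fun i _ => by push_cast; ring
      rw [hsum]
      simp only [hW']
      push_cast
      ring
  refine ⟨∫ x in Ω, W' x t, by simpa only [hgr, hut] using hderiv, ?_⟩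
  simp only [hut]
  have hc : 0 < 1 + t := by linarith
  set g : Fin N → EuclideanSpace ℝ (Fin N) → ℝ := fun i x =>
    Ut (x, t) * Ui i (x, t) * Real.exp (β * A x / (1 + t)) with hg
  have cg : ∀ i, ContDiff ℝ 1 (g i) := fun i => by
    have c1 : ContDiff ℝ 1 Ut := cUt.of_le (by exact mod_cast le_top)
    have c2 : ContDiff ℝ 1 (Ui i) := (cUi i).of_le (by exact mod_cast le_top)
    have c3 : ContDiff ℝ 1 A := hA.of_le (by norm_num)
    have c4 : ContDiff ℝ 1 fun x : EuclideanSpace ℝ (Fin N) => (x, t) :=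
      contDiff_id.prodMk contDiff_const
    exact ((c1.comp c4).mul (c2.comp c4)).mul ((contDiff_const.mul c3).div_const _).exp
  have hgc : ∀ i, HasCompactSupport (g i) := fun i =>
    HasCompactSupport.intro hK fun x hx => by simp [hg, hUt0 t htm x hx]
  have hg0 : ∀ i, ∀ x ∈ frontier Ω, g i x = 0 := fun i x hx => by
    have hev : u x =ᶠ[nhds t] fun _ => 0 := by
      filter_upwards [Ioi_mem_nhds ht] with s hs using hbdry x hx s hs
    have : Ut (x, t) = 0 := by rw [← hut, hev.deriv_eq, deriv_const]
    simp [hg, this]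
  have hgd : ∀ i x, fderiv ℝ (g i) x (EuclideanSpace.single i 1)
      = (fderiv ℝ (Ui i) (x, t) T * Ui i (x, t) + Ut (x, t) * fderiv ℝ (Ui i) (x, t) (e i)
        + Ut (x, t) * Ui i (x, t) * (β * fderiv ℝ A x (EuclideanSpace.single i 1) / (1 + t)))
        * Real.exp (β * A x / (1 + t)) := fun i x => by
    have s1 : fderiv ℝ (fun y => Ut (y, t)) x (EuclideanSpace.single i 1)
        = fderiv ℝ (Ui i) (x, t) T :=
      (fderiv_slice_left (dif cUt (x, t)) _).trans (fderiv_fderiv_apply_comm hu _ _ _)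
    have s2 : fderiv ℝ (fun y => Ui i (y, t)) x (EuclideanSpace.single i 1)
        = fderiv ℝ (Ui i) (x, t) (e i) := fderiv_slice_left (dif (cUi i) (x, t)) _
    have hpair : DifferentiableAt ℝ (fun y : EuclideanSpace ℝ (Fin N) => (y, t)) x := by fun_prop
    have d1 : HasFDerivAt (fun y => Ut (y, t)) (fderiv ℝ (fun y => Ut (y, t)) x) x :=
      (DifferentiableAt.comp (g := Ut) x (dif cUt (x, t)) hpair).hasFDerivAt
    have d2 : HasFDerivAt (fun y => Ui i (y, t)) (fderiv ℝ (fun y => Ui i (y, t)) x) x :=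
      (DifferentiableAt.comp (g := Ui i) x (dif (cUi i) (x, t)) hpair).hasFDerivAt
    have d3 : HasFDerivAt A (fderiv ℝ A x) x :=
      (hA.differentiable (by norm_num)).differentiableAt.hasFDerivAt
    have d4 : HasFDerivAt (fun y => β * A y / (1 + t)) _ x :=
      (d3.const_mul β).mul_const (1 + t)⁻¹
    have d5 := ((d1.fun_mul d2).fun_mul d4.exp).fderiv
    have d6 : fderiv ℝ (g i) x = _ := d5
    rw [d6]
    simp only [add_apply, smul_apply, smul_eq_mul, s1, s2]
    ring
  have hgint : ∀ i, IntegrableOn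
      (fun x => fderiv ℝ (g i) x (EuclideanSpace.single i 1)) Ω := fun i =>
    (((cg i).continuous_fderiv one_ne_zero).clm_apply
      continuous_const).integrable_of_hasCompactSupport
      ((hgc i).fderiv_apply (𝕜 := ℝ) _) |>.integrableOn
  have hdiv : ∫ x in Ω, ∑ i, 2 * fderiv ℝ (g i) x (EuclideanSpace.single i 1) = 0 := by
    rw [integral_finsetSum _ fun i _ => (hgint i).const_mul 2]
    refine Finset.sum_eq_zero fun i _ => ?_
    rw [integral_const_mul, setIntegral_fderiv_eq_zero volume hΩopen (cg i) (hgc i) (hg0 i),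
      mul_zero]
  set Q : EuclideanSpace ℝ (Fin N) → ℝ := fun x =>
    (a x + A x / (1 + t) ^ 2) * Ut (x, t) ^ 2 * Real.exp (β * A x / (1 + t)) with hQ
  have hQint : IntegrableOn Q Ω := by
    have c1 := cUt.continuous
    have c2 := ha.continuous
    have hQc : Continuous Q := by fun_prop
    exact (hQc.integrable_of_hasCompactSupport
      (HasCompactSupport.intro hK fun x hx => by simp [hQ, hUt0 t htm x hx])).integrableOn
  have hWint : IntegrableOn (fun x => W' x t) Ω := by
    have c1 := cUt.continuous
    have c2 := fun i => (cUi i).continuous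
    have c3 := cUtt.continuous
    have c4 := fun i => (cUit i).continuous
    have hWc : Continuous fun x => W' x t := by
      simp only [hW']
      fun_prop
    exact (hWc.integrable_of_hasCompactSupport (HasCompactSupport.intro hK fun x hx => by
      simp [hW', hUt0 t htm x hx, fun i => hUi0 i t htm x hx])).integrableOn
  have hsumint : IntegrableOn
      (fun x => ∑ i, 2 * fderiv ℝ (g i) x (EuclideanSpace.single i 1)) Ω :=
    integrable_finsetSum _ fun i _ => (hgint i).const_mul 2
  have hpt : ∀ x ∈ Ω, W' x t ≤ ∑ i, 2 * fderiv ℝ (g i) x (EuclideanSpace.single i 1)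
      - min (2 - β * h) β * Q x := fun x hx => by
    have hwave := hpde x hx t ht
    rw [hutt, hlap, hut] at hwave
    have hB := hgrad x hx
    rw [norm_gradient_sq] at hB
    have hcs := Finset.sum_mul_sq_le_sq_mul_sq Finset.univ (fun i => Ui i (x, t))
      fun i => fderiv ℝ A x (EuclideanSpace.single i 1)
    have hdis := weighted_dissipation_le (q := Ut (x, t)) hcs hB
      (Finset.sum_nonneg fun i _ => sq_nonneg _) (ha_pos x) (hA_pos x) hh hβ hc
    have hsum : ∑ i, 2 * fderiv ℝ (g i) x (EuclideanSpace.single i 1)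
        = (2 * ∑ i, Ui i (x, t) * fderiv ℝ (Ui i) (x, t) T
          + 2 * Ut (x, t) * ∑ i, fderiv ℝ (Ui i) (x, t) (e i)
          + 2 * (β * Ut (x, t)
            * (∑ i, Ui i (x, t) * fderiv ℝ A x (EuclideanSpace.single i 1)) / (1 + t)))
          * Real.exp (β * A x / (1 + t)) := by
      simp only [hgd, Finset.mul_sum, Finset.sum_div, ← Finset.sum_add_distrib, Finset.sum_mul]
      exact Finset.sum_congr rfl fun i _ => by ring
    have hE := mul_le_mul_of_nonneg_right hdis (Real.exp_pos (β * A x / (1 + t))).le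
    have hUtt : fderiv ℝ Ut (x, t) T
        = ∑ i, fderiv ℝ (Ui i) (x, t) (e i) - a x * Ut (x, t) := by linarith
    rw [hsum]
    simp only [hW', hQ, hUtt]
    linear_combination hE
  calc ∫ x in Ω, W' x t
      ≤ ∫ x in Ω, (∑ i, 2 * fderiv ℝ (g i) x (EuclideanSpace.single i 1)
        - min (2 - β * h) β * Q x) :=
        setIntegral_mono_on hWint (hsumint.sub (hQint.const_mul _)) hΩopen.measurableSet hpt
    _ = -(min (2 - β * h) β) * ∫ x in Ω, Q x := by
        rw [integral_sub hsumint (hQint.const_mul _), hdiv, integral_const_mul]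
        ring
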